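/- Let σ ∈ C¹_♯(Y₂) be positive with ∫_{Y₂} σ(y) dy = 1, and let u ∈ C²(ℝ²) be such that ∇u ∈ C¹_♯(Y₂)² vanishes nowhere and σ∇u is divergence free in ℝ². Set ζ := ∫_{Y₂} σ(y)∇u(y) dy and assume the ergodicity condition ζ·κ ≠ 0 for every κ ∈ ℤ²∖{0}. Then the flow X associated with the electric field b := ∇u satisfies: for every x ∈ ℝ², X(t,x)/t → ζ as t → ∞ (equivalently, the rotation set C_b is the singleton {ζ}). -/

import Mathlib

open MeasureTheory Filter Matrix

noncomputable section

/-- A function on `ℝ^d` is `ℤ^d`-periodic. -/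
def ZdPeriodic {d : ℕ} {E : Type*} (f : (Fin d → ℝ) → E) : Prop :=
  ∀ (κ : Fin d → ℤ) (x : Fin d → ℝ), f (x + fun i => (κ i : ℝ)) = f x

/-- The unit cube `[0,1)^d`, a fundamental domain for the torus `Y_d = ℝ^d/ℤ^d`. -/
def unitCube (d : ℕ) : Set (Fin d → ℝ) := {x | ∀ i, x i ∈ Set.Ico (0 : ℝ) 1}

/-- `X` is the global flow of the vector field `b`: `∂X/∂t(t,x) = b(X(t,x))`, `X(0,x) = x`. -/
def IsFlowOf {d : ℕ} (b : (Fin d → ℝ) → (Fin d → ℝ))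
    (X : ℝ → (Fin d → ℝ) → (Fin d → ℝ)) : Prop :=
  ∀ x : Fin d → ℝ, X 0 x = x ∧ ∀ t : ℝ, HasDerivAt (fun s => X s x) (b (X t x)) t

/-- A measure `μ` on the torus `Y_d` (identified with a measure on `ℝ^d` carried by the unit
cube) is invariant for the flow `X`: `∫ ψ(X(t,y)) dμ = ∫ ψ dμ` for all `t` and all continuous
`ℤ^d`-periodic `ψ`. -/
def FlowInvariant {d : ℕ} (X : ℝ → (Fin d → ℝ) → (Fin d → ℝ))
    (μ : Measure (Fin d → ℝ)) : Prop :=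
  ∀ (t : ℝ) (ψ : (Fin d → ℝ) → ℝ), Continuous ψ → ZdPeriodic ψ →
    ∫ y, ψ (X t y) ∂μ = ∫ y, ψ y ∂μ

/-- Herman's rotation set `C_b = {∫ b dμ : μ invariant probability measure for the flow}`. -/
def rotationSet {d : ℕ} (b : (Fin d → ℝ) → (Fin d → ℝ))
    (X : ℝ → (Fin d → ℝ) → (Fin d → ℝ)) : Set (Fin d → ℝ) :=
  {ζ | ∃ μ : Measure (Fin d → ℝ), IsProbabilityMeasure μ ∧ μ (unitCube d)ᶜ = 0 ∧
        FlowInvariant X μ ∧ ζ = ∫ y, b y ∂μ}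

/-- The gradient of a scalar function on `ℝ^d`. -/
def grad {d : ℕ} (ψ : (Fin d → ℝ) → ℝ) (y : Fin d → ℝ) : Fin d → ℝ :=
  fun i => fderiv ℝ ψ y (Pi.single i 1)

theorem existsUnique_add_mem_unitCube {d : ℕ} (x : Fin d → ℝ) :
    ∃! κ : Fin d → ℤ, (x + fun i => (κ i : ℝ)) ∈ unitCube d := by
  have h (i : Fin d) : ∃! n : ℤ, x i + n ∈ Set.Ico (0 : ℝ) 1 := by
    simpa using existsUnique_add_zsmul_mem_Ico (one_pos : (0 : ℝ) < 1) (x i) 0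
  choose κ hκ hu using h
  exact ⟨κ, hκ, fun κ' h' => funext fun i => hu i _ (h' i)⟩

theorem measurableSet_unitCube (d : ℕ) : MeasurableSet (unitCube d) :=
  MeasurableSet.univ_pi' fun _ => measurableSet_Ico

theorem unitCube_subset_Icc (d : ℕ) : unitCube d ⊆ Set.Icc 0 1 :=
  fun _ hx => ⟨fun i => (hx i).1, fun i => (hx i).2.le⟩

theorem unitCube_ae_eq_Icc (d : ℕ) :
    unitCube d =ᵐ[volume] Set.Icc (0 : Fin d → ℝ) 1 := by
  have : unitCube d = Set.univ.pi fun _ : Fin d => Set.Ico (0 : ℝ) 1 := by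
    ext; simp [unitCube]
  rw [this]
  exact Measure.univ_pi_Ico_ae_eq_Icc (μ := fun _ : Fin d => (volume : Measure ℝ))

theorem volume_unitCube (d : ℕ) : volume (unitCube d) = 1 := by
  rw [measure_congr (unitCube_ae_eq_Icc d), Real.volume_Icc_pi]
  simp

theorem Continuous.integrableOn_unitCube {d : ℕ} {E : Type*} [NormedAddCommGroup E]
    {f : (Fin d → ℝ) → E} (hf : Continuous f) : IntegrableOn f (unitCube d) :=
  (hf.integrableOn_Icc (a := 0) (b := 1)).mono_set (unitCube_subset_Icc d)

theorem ZdPeriodic.exists_isMaxOn {d : ℕ} {f : (Fin d → ℝ) → ℝ} (hf : ZdPeriodic f)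
    (hc : Continuous f) : ∃ y₀, ∀ y, f y ≤ f y₀ := by
  obtain ⟨y₀, -, h⟩ := (isCompact_Icc (a := (0 : Fin d → ℝ)) (b := 1)).exists_isMaxOn
    ⟨0, by simp⟩ hc.continuousOn
  refine ⟨y₀, fun y => ?_⟩
  obtain ⟨κ, hκ, -⟩ := existsUnique_add_mem_unitCube y
  rw [← hf κ y]
  exact h (unitCube_subset_Icc d hκ)

theorem ZdPeriodic.exists_norm_le {d : ℕ} {E : Type*} [NormedAddCommGroup E]
    {f : (Fin d → ℝ) → E} (hf : ZdPeriodic f) (hc : Continuous f) : ∃ C, ∀ y, ‖f y‖ ≤ C := by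
  have hp : ZdPeriodic fun y => ‖f y‖ := fun κ y => congrArg norm (hf κ y)
  obtain ⟨y₀, h⟩ := hp.exists_isMaxOn hc.norm
  exact ⟨_, h⟩

theorem ZdPeriodic.exists_pos_le {d : ℕ} {f : (Fin d → ℝ) → ℝ} (hf : ZdPeriodic f)
    (hc : Continuous f) (hpos : ∀ y, 0 < f y) : ∃ m > 0, ∀ y, m ≤ f y := by
  have hp : ZdPeriodic fun y => -f y := fun κ y => congrArg Neg.neg (hf κ y)
  obtain ⟨y₀, h⟩ := hp.exists_isMaxOn hc.neg
  exact ⟨f y₀, hpos y₀, fun y => neg_le_neg_iff.1 (h y)⟩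

theorem isAddFundamentalDomain_of_existsUnique {d : ℕ} {D : Set (Fin d → ℝ)}
    (hD : MeasurableSet D)
    (hu : ∀ x : Fin d → ℝ, ∃! κ : Fin d → ℤ, (x + fun i => (κ i : ℝ)) ∈ D) :
    IsAddFundamentalDomain (Submodule.span ℤ (Set.range (Pi.basisFun ℝ (Fin d)))) D volume := by
  refine IsAddFundamentalDomain.mk' hD.nullMeasurableSet fun x => ?_
  obtain ⟨κ, hκ, huniq⟩ := hu x
  refine ⟨⟨fun i => (κ i : ℝ), ?_⟩, ?_, ?_⟩
  · rw [Module.Basis.mem_span_iff_repr_mem]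
    intro i
    exact ⟨κ i, by simp⟩
  · simpa [Submodule.vadd_def, add_comm] using hκ
  · rintro ⟨g, hg⟩ h
    rw [Module.Basis.mem_span_iff_repr_mem] at hg
    choose κ' hκ' using hg
    have hg : g = fun i => (κ' i : ℝ) := funext fun i => by simpa using (hκ' i).symm
    subst hg
    have := huniq κ' (by simpa [Submodule.vadd_def, add_comm] using h)
    subst this
    rfl

/-- Any two measurable fundamental domains of `ℤ^d` carry the same integral of a periodic
function. -/
theorem ZdPeriodic.setIntegral_eq {d : ℕ} {E : Type*} [NormedAddCommGroup E] [NormedSpace ℝ E]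
    {f : (Fin d → ℝ) → E} (hf : ZdPeriodic f) {D : Set (Fin d → ℝ)} (hD : MeasurableSet D)
    (hu : ∀ x : Fin d → ℝ, ∃! κ : Fin d → ℤ, (x + fun i => (κ i : ℝ)) ∈ D) :
    ∫ y in D, f y = ∫ y in unitCube d, f y := by
  have : VAddInvariantMeasure (Submodule.span ℤ (Set.range (Pi.basisFun ℝ (Fin d))))
      (Fin d → ℝ) volume :=
    ⟨fun c s _ => measure_preimage_add volume (c : Fin d → ℝ) s⟩
  refine (isAddFundamentalDomain_of_existsUnique hD hu).setIntegral_eq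
    (isAddFundamentalDomain_of_existsUnique (measurableSet_unitCube d)
      existsUnique_add_mem_unitCube) ?_
  rintro ⟨g, hg⟩ x
  rw [Module.Basis.mem_span_iff_repr_mem] at hg
  choose κ hκ using hg
  have hg : g = fun i => (κ i : ℝ) := funext fun i => by simpa using (hκ i).symm
  subst hg
  simpa [Submodule.vadd_def, add_comm] using hf κ x

theorem ZdPeriodic.setIntegral_comp_add {d : ℕ} {E : Type*} [NormedAddCommGroup E]
    [NormedSpace ℝ E] {f : (Fin d → ℝ) → E} (hf : ZdPeriodic f) (a : Fin d → ℝ) :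
    ∫ y in unitCube d, f (y + a) = ∫ y in unitCube d, f y := by
  have h := (measurePreserving_add_right (volume : Measure (Fin d → ℝ)) a).setIntegral_image_emb
    (MeasurableEquiv.addRight a).measurableEmbedding f (unitCube d)
  rw [← h]
  refine hf.setIntegral_eq
    ((MeasurableEquiv.addRight a).measurableEmbedding.measurableSet_image'
      (measurableSet_unitCube d)) fun x => ?_
  have := existsUnique_add_mem_unitCube (x - a)
  convert this using 2 with κ
  simp [sub_eq_add_neg, add_right_comm]

/-- The projection of `ℝ^d` onto the torus. -/
def toTorus {d : ℕ} (x : Fin d → ℝ) : UnitAddTorus (Fin d) := fun i => (x i : UnitAddCircle)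

theorem isOpenQuotientMap_toTorus (d : ℕ) : IsOpenQuotientMap (toTorus (d := d)) :=
  IsOpenQuotientMap.piMap fun _ => QuotientAddGroup.isOpenQuotientMap_mk

theorem toTorus_periodic {d : ℕ} : ZdPeriodic (toTorus (d := d)) := by
  intro κ x
  funext i
  simp [toTorus]

theorem exists_eq_add_of_toTorus_eq {d : ℕ} {x y : Fin d → ℝ} (h : toTorus x = toTorus y) :
    ∃ κ : Fin d → ℤ, x = y + fun i => (κ i : ℝ) := by
  have h' (i : Fin d) : ∃ n : ℤ, x i = y i + n := by
    have hi : ((x i - y i : ℝ) : UnitAddCircle) = 0 := by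
      rw [AddCircle.coe_sub, sub_eq_zero]
      exact congrFun h i
    rw [AddCircle.coe_eq_zero_iff] at hi
    obtain ⟨n, hn⟩ := hi
    refine ⟨n, ?_⟩
    simp only [zsmul_eq_mul, mul_one] at hn
    rw [hn]
    ring
  choose κ hκ using h'
  exact ⟨κ, funext hκ⟩

theorem ZdPeriodic.exists_continuousMap {d : ℕ} {h : (Fin d → ℝ) → ℝ} (hp : ZdPeriodic h)
    (hc : Continuous h) : ∃ f : C(UnitAddTorus (Fin d), ℂ), ∀ x, f (toTorus x) = h x := by
  have hc' : Continuous fun x => (h x : ℂ) := Complex.continuous_ofReal.comp hc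
  let π : C(Fin d → ℝ, UnitAddTorus (Fin d)) := ⟨toTorus, (isOpenQuotientMap_toTorus d).continuous⟩
  have hq : Topology.IsQuotientMap π := (isOpenQuotientMap_toTorus d).isQuotientMap
  have hf : Function.FactorsThrough (⟨fun x => (h x : ℂ), hc'⟩ : C(Fin d → ℝ, ℂ)) π := by
    intro x y hxy
    obtain ⟨κ, rfl⟩ := exists_eq_add_of_toTorus_eq hxy
    exact congrArg Complex.ofReal (hp κ y)
  exact ⟨hq.lift _ hf, fun x => congrArg (fun g : C(Fin d → ℝ, ℂ) => g x) (hq.lift_comp _ hf)⟩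

theorem mFourier_toTorus {d : ℕ} (n : Fin d → ℤ) (x : Fin d → ℝ) :
    UnitAddTorus.mFourier n (toTorus x) =
      Complex.exp (2 * Real.pi * Complex.I * ((x ⬝ᵥ fun i => (n i : ℝ) : ℝ) : ℂ)) := by
  simp only [UnitAddTorus.mFourier, toTorus, ContinuousMap.coe_mk, fourier_coe_apply,
    ← Complex.exp_sum, dotProduct]
  congr 1
  push_cast
  rw [Finset.mul_sum]
  refine Finset.sum_congr rfl fun i _ => ?_
  ring

theorem setIntegral_mFourier_toTorus {d : ℕ} {n : Fin d → ℤ} (hn : n ≠ 0) :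
    ∫ x in unitCube d, UnitAddTorus.mFourier n (toTorus x) = 0 := by
  obtain ⟨j, hj⟩ := Function.ne_iff.1 hn
  have hj' : (n j : ℝ) ≠ 0 := by exact_mod_cast hj
  have hp : ZdPeriodic fun x : Fin d → ℝ => UnitAddTorus.mFourier n (toTorus x) :=
    fun κ x => congrArg _ (toTorus_periodic κ x)
  have h := hp.setIntegral_comp_add (Pi.single j (1 / (2 * n j)))
  have hs (x : Fin d → ℝ) :
      UnitAddTorus.mFourier n (toTorus (x + Pi.single j (1 / (2 * (n j : ℝ))))) =
        -UnitAddTorus.mFourier n (toTorus x) := by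
    rw [mFourier_toTorus, mFourier_toTorus, add_dotProduct, single_dotProduct,
      show 1 / (2 * (n j : ℝ)) * n j = 1 / 2 by field_simp]
    push_cast
    rw [mul_add, Complex.exp_add, show 2 * (Real.pi : ℂ) * Complex.I * (1 / 2) =
      Real.pi * Complex.I by ring, Complex.exp_pi_mul_I]
    ring
  simp_rw [hs] at h
  rw [integral_neg] at h
  exact CharZero.eq_neg_self_iff.1 h.symm

/-- The time averages of `f` along every line of direction `ω` in the torus converge to the mean
value of `f`. -/
def LineAveragesConverge {d : ℕ} (ω : Fin d → ℝ) (f : C(UnitAddTorus (Fin d), ℂ)) : Prop :=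
  ∀ z : Fin d → ℝ, Tendsto (fun S : ℝ => (S : ℂ)⁻¹ * ∫ s in 0..S, f (toTorus (z + s • ω))) atTop
    (nhds (∫ x in unitCube d, f (toTorus x)))

theorem continuous_comp_line {d : ℕ} (ω : Fin d → ℝ) (f : C(UnitAddTorus (Fin d), ℂ))
    (z : Fin d → ℝ) : Continuous fun s : ℝ => f (toTorus (z + s • ω)) :=
  f.continuous.comp ((isOpenQuotientMap_toTorus d).continuous.comp (by fun_prop))

theorem lineAveragesConverge_mFourier {d : ℕ} {ω : Fin d → ℝ}
    (hω : ∀ κ : Fin d → ℤ, κ ≠ 0 → ω ⬝ᵥ (fun i => (κ i : ℝ)) ≠ 0) (n : Fin d → ℤ) :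
    LineAveragesConverge ω (UnitAddTorus.mFourier n) := by
  intro z
  by_cases hn : n = 0
  · subst hn
    simp only [UnitAddTorus.mFourier_zero, ContinuousMap.one_apply, integral_const,
      intervalIntegral.integral_const]
    refine tendsto_nhds_of_eventually_eq ?_
    filter_upwards [eventually_gt_atTop 0] with S hS
    simp [Measure.real, volume_unitCube, hS.ne']
  · rw [setIntegral_mFourier_toTorus hn]
    set c : ℂ := 2 * Real.pi * Complex.I * ((ω ⬝ᵥ fun i => (n i : ℝ) : ℝ) : ℂ) with hc
    have hc0 : c ≠ 0 := by
      have := hω n hn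
      simp only [hc, ne_eq, mul_eq_zero, Complex.ofReal_eq_zero, not_or]
      exact ⟨⟨⟨by norm_num, Real.pi_ne_zero⟩, Complex.I_ne_zero⟩, this⟩
    have hI (S : ℝ) : ∫ s in 0..S, UnitAddTorus.mFourier n (toTorus (z + s • ω)) =
        UnitAddTorus.mFourier n (toTorus z) * ((Complex.exp (c * S) - 1) / c) := by
      have : ∀ s : ℝ, UnitAddTorus.mFourier n (toTorus (z + s • ω)) =
          UnitAddTorus.mFourier n (toTorus z) * Complex.exp (c * s) := by
        intro s
        rw [mFourier_toTorus, mFourier_toTorus, ← Complex.exp_add, add_dotProduct,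
          smul_dotProduct, hc]
        congr 1
        push_cast
        simp only [smul_eq_mul, Complex.ofReal_mul]
        ring
      simp_rw [this]
      rw [intervalIntegral.integral_const_mul, integral_exp_mul_complex hc0]
      simp
    simp_rw [hI]
    have hexp (S : ℝ) : ‖Complex.exp (c * S)‖ = 1 := by
      rw [Complex.norm_exp, hc]
      simp
    refine squeeze_zero_norm (a := fun S : ℝ => |S|⁻¹ * (2 / ‖c‖)) (fun S => ?_) ?_
    · have h1 : ‖UnitAddTorus.mFourier n (toTorus z)‖ ≤ 1 :=
        (ContinuousMap.norm_coe_le_norm _ _).trans_eq UnitAddTorus.mFourier_norm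
      have h2 : ‖Complex.exp (c * S) - 1‖ ≤ 2 := by
        refine (norm_sub_le _ _).trans ?_
        rw [hexp, norm_one]
        norm_num
      rw [norm_mul, norm_mul, norm_div, norm_inv, Complex.norm_real, Real.norm_eq_abs]
      gcongr
      calc _ ≤ 1 * (2 / ‖c‖) := by gcongr
        _ = _ := one_mul _
    · have : Tendsto (fun S : ℝ => |S|⁻¹) atTop (nhds 0) :=
        tendsto_inv_atTop_zero.comp tendsto_abs_atTop_atTop
      simpa using this.mul_const (2 / ‖c‖)

theorem lineAveragesConverge_of_closure {d : ℕ} {ω : Fin d → ℝ}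
    {s : Set C(UnitAddTorus (Fin d), ℂ)} (hs : ∀ g ∈ s, LineAveragesConverge ω g)
    {f : C(UnitAddTorus (Fin d), ℂ)} (hf : f ∈ closure s) : LineAveragesConverge ω f := by
  intro z
  rw [Metric.tendsto_nhds]
  intro ε hε
  obtain ⟨g, hg, hfg⟩ := Metric.mem_closure_iff.1 hf (ε / 3) (by positivity)
  have hle (x) : ‖f x - g x‖ ≤ ε / 3 := by
    rw [← dist_eq_norm]
    exact (ContinuousMap.dist_apply_le_dist x).trans hfg.le
  have hint (k : C(UnitAddTorus (Fin d), ℂ)) :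
      IntegrableOn (fun x : Fin d → ℝ => k (toTorus x)) (unitCube d) :=
    (k.continuous.comp (isOpenQuotientMap_toTorus d).continuous).integrableOn_unitCube
  have h2 : ‖(∫ x in unitCube d, f (toTorus x)) - ∫ x in unitCube d, g (toTorus x)‖ ≤ ε / 3 := by
    rw [← integral_sub (hint f) (hint g)]
    have := norm_setIntegral_le_of_norm_le_const (μ := volume) (s := unitCube d)
      (C := ε / 3) (f := fun x => f (toTorus x) - g (toTorus x))
      (by simp [volume_unitCube]) (fun x _ => hle _)
    simpa [Measure.real, volume_unitCube] using this
  filter_upwards [(Metric.tendsto_nhds.1 (hs g hg z)) (ε / 3) (by positivity),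
    eventually_gt_atTop 0] with S hS hS0
  have h1 : ‖(S : ℂ)⁻¹ * (∫ s in 0..S, f (toTorus (z + s • ω))) -
      (S : ℂ)⁻¹ * ∫ s in 0..S, g (toTorus (z + s • ω))‖ ≤ ε / 3 := by
    rw [← mul_sub, ← intervalIntegral.integral_sub
      ((continuous_comp_line ω f z).intervalIntegrable _ _)
      ((continuous_comp_line ω g z).intervalIntegrable _ _)]
    have := intervalIntegral.norm_integral_le_of_norm_le_const (a := 0) (b := S) (C := ε / 3)
      (f := fun s => f (toTorus (z + s • ω)) - g (toTorus (z + s • ω))) (fun s _ => hle _)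
    rw [norm_mul, norm_inv, Complex.norm_real, Real.norm_eq_abs, abs_of_pos hS0]
    rw [sub_zero, abs_of_pos hS0] at this
    rw [inv_mul_le_iff₀ hS0]
    linarith
  rw [dist_eq_norm] at hS ⊢
  have h3 := norm_sub_rev (∫ x in unitCube d, f (toTorus x)) (∫ x in unitCube d, g (toTorus x))
  rw [h3] at h2
  calc _ = ‖((S : ℂ)⁻¹ * (∫ s in 0..S, f (toTorus (z + s • ω))) -
        (S : ℂ)⁻¹ * ∫ s in 0..S, g (toTorus (z + s • ω))) +
        ((S : ℂ)⁻¹ * (∫ s in 0..S, g (toTorus (z + s • ω))) -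
          ∫ x in unitCube d, g (toTorus x)) +
        ((∫ x in unitCube d, g (toTorus x)) - ∫ x in unitCube d, f (toTorus x))‖ := by
        congr 1; ring
    _ ≤ _ := norm_add₃_le
    _ < ε := by linarith

theorem lineAveragesConverge {d : ℕ} {ω : Fin d → ℝ}
    (hω : ∀ κ : Fin d → ℤ, κ ≠ 0 → ω ⬝ᵥ (fun i => (κ i : ℝ)) ≠ 0)
    (f : C(UnitAddTorus (Fin d), ℂ)) : LineAveragesConverge ω f := by
  have hint (k : C(UnitAddTorus (Fin d), ℂ)) :
      IntegrableOn (fun x : Fin d → ℝ => k (toTorus x)) (unitCube d) :=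
    (k.continuous.comp (isOpenQuotientMap_toTorus d).continuous).integrableOn_unitCube
  refine lineAveragesConverge_of_closure
    (s := Submodule.span ℂ (Set.range (UnitAddTorus.mFourier (d := Fin d)))) (fun g hg => ?_) ?_
  · induction hg using Submodule.span_induction with
    | mem g hg =>
      obtain ⟨n, rfl⟩ := hg
      exact lineAveragesConverge_mFourier hω n
    | zero => intro z; simp
    | add f g _ _ hf hg =>
      intro z
      convert (hf z).add (hg z) using 2 with S
      · rw [← mul_add, ← intervalIntegral.integral_add
          ((continuous_comp_line ω f z).intervalIntegrable _ _)
          ((continuous_comp_line ω g z).intervalIntegrable _ _)]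
        rfl
      · exact integral_add (hint f) (hint g)
    | smul c f _ hf =>
      intro z
      convert (hf z).const_mul c using 2 with S
      · simp only [ContinuousMap.smul_apply, smul_eq_mul, intervalIntegral.integral_const_mul]
        ring
      · exact integral_const_mul _ _
  · have := UnitAddTorus.span_mFourier_closure_eq_top (d := Fin d)
    rw [← Submodule.topologicalClosure_coe, this]
    trivial

/-- **Kronecker–Weyl equidistribution** of the lines of rationally independent direction. -/
theorem ZdPeriodic.tendsto_average_line {d : ℕ} {ω : Fin d → ℝ}
    (hω : ∀ κ : Fin d → ℤ, κ ≠ 0 → ω ⬝ᵥ (fun i => (κ i : ℝ)) ≠ 0)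
    {h : (Fin d → ℝ) → ℝ} (hp : ZdPeriodic h) (hc : Continuous h) (z : Fin d → ℝ) :
    Tendsto (fun S : ℝ => S⁻¹ * ∫ s in 0..S, h (z + s • ω)) atTop
      (nhds (∫ x in unitCube d, h x)) := by
  obtain ⟨f, hf⟩ := hp.exists_continuousMap hc
  have := lineAveragesConverge hω f z
  simp_rw [hf] at this
  rw [← tendsto_ofReal_iff]
  convert this using 2 with S
  · rw [intervalIntegral.integral_ofReal]
    push_cast
    rfl
  · exact integral_ofReal.symm

theorem isCoveringMap_of_isLocalHomeomorph_of_isProperMap {E F : Type*} [TopologicalSpace E]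
    [TopologicalSpace F] [T2Space E] [T1Space F] {f : E → F} (hf : IsLocalHomeomorph f)
    (hp : IsProperMap f) : IsCoveringMap f := by
  rw [isCoveringMap_iff_isCoveringMapOn_univ]
  have hf' : IsLocalHomeomorphOn f (f ⁻¹' Set.univ) := hf.isLocalHomeomorphOn
  refine hp.isClosedMap.isCoveringMapOn_of_isLocalHomeomorphOn (fun x _ => ?_) hf'
  refine (hp.isCompact_preimage isCompact_singleton).finite
    (IsDiscrete.of_openPartialHomeomorph f subset_rfl fun e _ => ?_)
  obtain ⟨φ, hφ, h⟩ := hf e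
  exact ⟨φ, hφ, h.symm⟩

/-- A covering map from a connected space to a simply connected one is a homeomorphism. -/
theorem IsCoveringMap.exists_homeomorph {E F : Type*} [TopologicalSpace E] [TopologicalSpace F]
    [PreconnectedSpace E] [Nonempty E] [SimplyConnectedSpace F] [LocallyPathConnectedSpace F]
    {f : E → F} (hf : IsCoveringMap f) : ∃ e : E ≃ₜ F, ⇑e = f := by
  obtain ⟨x₀⟩ := ‹Nonempty E›
  obtain ⟨g, ⟨hg₀, hg⟩, -⟩ :=
    hf.existsUnique_continuousMap_lifts (ContinuousMap.id F) (f x₀) x₀ rfl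
  have hr (y : F) : f (g y) = y := congrFun hg y
  have hl : g ∘ f = id := by
    refine hf.eq_of_comp_eq (g.continuous.comp hf.continuous) continuous_id ?_ x₀ hg₀
    funext x
    exact hr (f x)
  exact ⟨⟨⟨f, g, congrFun hl, hr⟩, hf.continuous, g.continuous⟩, rfl⟩

/-- A `C¹` local diffeomorphism of `ℝ^d` commuting with integer translations is a
homeomorphism. -/
theorem exists_homeomorph_of_equivariant {d : ℕ} {G : (Fin d → ℝ) → (Fin d → ℝ)}
    (hG : ContDiff ℝ 1 G) (hdet : ∀ y, (fderiv ℝ G y).det ≠ 0)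
    (heq : ∀ (κ : Fin d → ℤ) (y : Fin d → ℝ),
      G (y + fun i => (κ i : ℝ)) = G y + fun i => (κ i : ℝ)) :
    ∃ e : (Fin d → ℝ) ≃ₜ (Fin d → ℝ), ⇑e = G := by
  have hper : ZdPeriodic fun y => G y - y := fun κ y => by simp [heq κ y]
  obtain ⟨C, hC⟩ := hper.exists_norm_le (hG.continuous.sub continuous_id)
  have hprop : IsProperMap G := by
    rw [isProperMap_iff_tendsto_cocompact]
    refine ⟨hG.continuous, ?_⟩
    rw [← Metric.cobounded_eq_cocompact, ← tendsto_norm_atTop_iff_cobounded]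
    refine tendsto_atTop_mono (f := fun y => ‖y‖ - C) (fun y => ?_)
      (tendsto_atTop_add_const_right _ _ tendsto_norm_cobounded_atTop)
    have := norm_sub_norm_le y (y - G y)
    rw [norm_sub_rev y (G y), sub_sub_cancel] at this
    linarith [hC y]
  have hloc : IsLocalHomeomorph G := by
    intro y
    have hd : HasFDerivAt G
        (((fderiv ℝ G y).toContinuousLinearEquivOfDetNeZero (hdet y) :
          (Fin d → ℝ) ≃L[ℝ] (Fin d → ℝ)) : (Fin d → ℝ) →L[ℝ] (Fin d → ℝ)) y := by
      have := (hG.differentiable one_ne_zero y).hasFDerivAt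
      simpa using this
    exact ⟨hG.contDiffAt.toOpenPartialHomeomorph G hd one_ne_zero,
      hG.contDiffAt.mem_toOpenPartialHomeomorph_source hd one_ne_zero,
      (hG.contDiffAt.toOpenPartialHomeomorph_coe hd one_ne_zero).symm⟩
  exact (isCoveringMap_of_isLocalHomeomorph_of_isProperMap hloc hprop).exists_homeomorph

/-- A function with periodic derivative is the sum of a linear function and a periodic one. -/
theorem exists_forall_add_eq_of_periodic_fderiv {d : ℕ} {w : (Fin d → ℝ) → ℝ}
    (hw : Differentiable ℝ w) (hp : ZdPeriodic (fderiv ℝ w)) :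
    ∃ η : Fin d → ℝ, ∀ (κ : Fin d → ℤ) (y : Fin d → ℝ),
      w (y + fun i => (κ i : ℝ)) = w y + η ⬝ᵥ fun i => (κ i : ℝ) := by
  have hd (κ : Fin d → ℤ) : Differentiable ℝ fun y => w (y + fun i => (κ i : ℝ)) :=
    hw.comp (differentiable_id.add_const _)
  have hconst (κ : Fin d → ℤ) (y : Fin d → ℝ) :
      w (y + fun i => (κ i : ℝ)) - w y = w (0 + fun i => (κ i : ℝ)) - w 0 := by
    refine is_const_of_fderiv_eq_zero (𝕜 := ℝ)
      (f := fun y => w (y + fun i => (κ i : ℝ)) - w y) ?_ (fun y => ?_) y 0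
    · exact (hd κ).sub hw
    · rw [fderiv_fun_sub (hd κ y) (hw y), fderiv_comp_add_right, hp κ y, sub_self]
  let c : (Fin d → ℤ) →+ ℝ :=
    { toFun := fun κ => w (0 + fun i => (κ i : ℝ)) - w 0
      map_zero' := by simp [← Pi.zero_def]
      map_add' := fun κ κ' => by
        have h := hconst κ' (0 + fun i => (κ i : ℝ))
        rw [← h]
        simp [Pi.add_def] }
  have hc (κ : Fin d → ℤ) : c κ = (fun i => c (Pi.single i 1)) ⬝ᵥ fun i => (κ i : ℝ) := by
    have h := congrArg c (Finset.univ_sum_single κ)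
    rw [← h, map_sum]
    refine Finset.sum_congr rfl fun i _ => ?_
    have : (Pi.single i (κ i) : Fin d → ℤ) = κ i • Pi.single i 1 := by
      rw [← Pi.single_smul]; simp
    rw [this, map_zsmul, zsmul_eq_mul, mul_comm]
  refine ⟨fun i => c (Pi.single i 1), fun κ y => ?_⟩
  rw [← hc, ← sub_eq_iff_eq_add']
  exact hconst κ y

theorem setIntegral_fderiv_unitCube {n : ℕ} {w : (Fin (n + 1) → ℝ) → ℝ} (hw : ContDiff ℝ 1 w)
    {η : Fin (n + 1) → ℝ} (hη : ∀ (κ : Fin (n + 1) → ℤ) (y : Fin (n + 1) → ℝ),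
      w (y + fun i => (κ i : ℝ)) = w y + η ⬝ᵥ fun i => (κ i : ℝ)) (i : Fin (n + 1)) :
    ∫ y in unitCube (n + 1), fderiv ℝ w y (Pi.single i 1) = η i := by
  have hfc : Continuous fun y => fderiv ℝ w y (Pi.single i 1) :=
    (hw.continuous_fderiv one_ne_zero).clm_apply continuous_const
  rw [setIntegral_congr_set (unitCube_ae_eq_Icc (n + 1))]
  have h := integral_divergence_of_hasFDerivAt_off_countable' (0 : Fin (n + 1) → ℝ) 1
    (fun _ => zero_le_one) (fun j => if j = i then w else 0)
    (fun j => if j = i then fderiv ℝ w else 0) ∅ Set.countable_empty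
    (fun j => by
      split_ifs
      · exact hw.continuous.continuousOn
      · exact continuousOn_const)
    (fun x _ j => by
      split_ifs
      · exact (hw.differentiable one_ne_zero x).hasFDerivAt
      · exact hasFDerivAt_const _ _)
    (by
      refine ContinuousOn.integrableOn_compact isCompact_Icc (Continuous.continuousOn ?_)
      refine continuous_finsetSum _ fun j _ => ?_
      split_ifs with hj
      · exact hj ▸ hfc
      · exact continuous_const)
  have hL : (fun x => ∑ j, (if j = i then fderiv ℝ w else 0) x (Pi.single j 1)) =
      fun x => fderiv ℝ w x (Pi.single i 1) := by
    funext x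
    rw [Finset.sum_eq_single i] <;> simp +contextual
  rw [hL] at h
  rw [h, Finset.sum_eq_single i]
  · simp only [if_true]
    have hface (x : Fin n → ℝ) : w (i.insertNth 1 x) = w (i.insertNth 0 x) + η i := by
      have := hη (Pi.single i 1) (i.insertNth 0 x)
      convert this using 2
      · funext k
        refine Fin.succAboveCases i ?_ (fun k => ?_) k <;> simp
      · simp [dotProduct, Pi.single_apply]
    have hcont (a : ℝ) : Continuous fun x : Fin n → ℝ => w (i.insertNth a x) :=
      hw.continuous.comp (continuous_const.finInsertNth i continuous_id)
    rw [← integral_sub]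
    · simp [hface, Measure.real, Real.volume_Icc_pi]
    · exact (hcont _).integrableOn_Icc
    · exact (hcont _).integrableOn_Icc
  · intro j _ hj
    simp [hj]
  · simp

theorem ContinuousLinearMap.apply_eq_dotProduct {d : ℕ} (L : (Fin d → ℝ) →L[ℝ] ℝ)
    (w : Fin d → ℝ) : L w = w ⬝ᵥ fun i => L (Pi.single i 1) := by
  conv_lhs => rw [pi_eq_sum_univ' w]
  simp only [map_sum, map_smul, dotProduct, smul_eq_mul]

theorem ZdPeriodic.fderiv_of_grad {d : ℕ} {u : (Fin d → ℝ) → ℝ}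
    (hp : ZdPeriodic fun y => grad u y) : ZdPeriodic (fderiv ℝ u) := by
  intro κ y
  ext w
  rw [ContinuousLinearMap.apply_eq_dotProduct, ContinuousLinearMap.apply_eq_dotProduct]
  exact congrArg (w ⬝ᵥ ·) (hp κ y)

theorem contDiff_grad {d : ℕ} {u : (Fin d → ℝ) → ℝ} (hu : ContDiff ℝ 2 u) :
    ContDiff ℝ 1 fun y => grad u y :=
  contDiff_pi.2 fun _ => (hu.fderiv_right (by norm_num)).clm_apply contDiff_const

/-- **Poincaré lemma** in the plane. -/
theorem exists_contDiff_grad_eq {p q : (Fin 2 → ℝ) → ℝ} (hp : ContDiff ℝ 1 p)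
    (hq : ContDiff ℝ 1 q)
    (hpq : ∀ y, fderiv ℝ p y (Pi.single 1 1) = fderiv ℝ q y (Pi.single 0 1)) :
    ∃ v : (Fin 2 → ℝ) → ℝ, ContDiff ℝ 1 v ∧ ∀ y, grad v y = ![p y, q y] := by
  let P : Fin 2 → (Fin 2 → ℝ) →L[ℝ] ℝ := fun i => ContinuousLinearMap.proj i
  let θ : (Fin 2 → ℝ) → (Fin 2 → ℝ) →L[ℝ] ℝ := fun y => p y • P 0 + q y • P 1
  have hpd := hp.differentiable one_ne_zero
  have hqd := hq.differentiable one_ne_zero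
  have hθ (y) : HasFDerivAt θ ((fderiv ℝ p y).smulRight (P 0) + (fderiv ℝ q y).smulRight (P 1)) y :=
    ((hpd y).hasFDerivAt.smul_const (P 0)).add ((hqd y).hasFDerivAt.smul_const (P 1))
  obtain ⟨v, hv⟩ := Convex.exists_forall_hasFDerivAt_of_fderiv_symmetric (ω := θ)
    (convex_univ (𝕜 := ℝ)) isOpen_univ (fun y _ => (hθ y).differentiableAt.differentiableWithinAt)
    (fun a _ x y => by
      rw [(hθ a).fderiv]
      have h := hpq a
      simp only [_root_.add_apply, ContinuousLinearMap.smulRight_apply, P,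
        _root_.smul_apply, ContinuousLinearMap.proj_apply, smul_eq_mul,
        (fderiv ℝ p a).apply_eq_dotProduct x, (fderiv ℝ p a).apply_eq_dotProduct y,
        (fderiv ℝ q a).apply_eq_dotProduct x, (fderiv ℝ q a).apply_eq_dotProduct y,
        dotProduct, Fin.sum_univ_two]
      rw [h]
      ring)
  have hfd : fderiv ℝ v = θ := funext fun y => (hv y trivial).fderiv
  refine ⟨v, ?_, fun y => ?_⟩
  · rw [contDiff_one_iff_fderiv]
    refine ⟨fun y => (hv y trivial).differentiableAt, ?_⟩
    rw [hfd]
    exact (hp.continuous.smul continuous_const).add (hq.continuous.smul continuous_const)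
  · funext i
    rw [grad, hfd]
    fin_cases i <;> simp [θ, P]

theorem dotProduct_self_pos_of_ne_zero {d : ℕ} {w : Fin d → ℝ} (hw : w ≠ 0) : 0 < w ⬝ᵥ w :=
  (Finset.sum_nonneg fun i _ => mul_self_nonneg (w i)).lt_of_ne'
    fun h => hw (dotProduct_self_eq_zero.1 h)

theorem grad_eq_zero_of_forall_le {d : ℕ} {w : (Fin d → ℝ) → ℝ} {y₀ : Fin d → ℝ}
    (h : ∀ y, w y ≤ w y₀) : grad w y₀ = 0 := by
  have hmax : IsLocalMax w y₀ := Eventually.of_forall h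
  funext i
  simp [grad, hmax.fderiv_eq_zero]

/-- An electric field `∇u` in the plane with divergence free current `σ∇u` is straightened, up to
a change of time, by a homeomorphism of the torus. -/
theorem exists_straightening
    {σ : (Fin 2 → ℝ) → ℝ} (hσ : ContDiff ℝ 1 σ) (hσper : ZdPeriodic σ) (hσpos : ∀ y, 0 < σ y)
    {u : (Fin 2 → ℝ) → ℝ} (hu : ContDiff ℝ 2 u)
    (huper : ZdPeriodic fun y => grad u y) (hune : ∀ y, grad u y ≠ 0)
    (hdiv : ∀ y : Fin 2 → ℝ,
      ∑ i : Fin 2, fderiv ℝ (fun z => σ z * grad u z i) y (Pi.single i 1) = 0)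
    {ζ : Fin 2 → ℝ} (hζ : ζ = ∫ y in unitCube 2, σ y • grad u y)
    (herg : ∀ κ : Fin 2 → ℤ, κ ≠ 0 → ζ ⬝ᵥ (fun i => (κ i : ℝ)) ≠ 0) :
    ∃ (e : (Fin 2 → ℝ) ≃ₜ (Fin 2 → ℝ)) (ω : Fin 2 → ℝ) (c : ℝ),
      0 < c ∧ (∀ κ : Fin 2 → ℤ, κ ≠ 0 → ω ⬝ᵥ (fun i => (κ i : ℝ)) ≠ 0) ∧
      Differentiable ℝ e ∧
      (∀ (κ : Fin 2 → ℤ) (y : Fin 2 → ℝ),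
        e (y + fun i => (κ i : ℝ)) = e y + fun i => (κ i : ℝ)) ∧
      (∀ y, fderiv ℝ e y (grad u y) = (grad u y ⬝ᵥ grad u y) • ω) ∧
      ∀ y, |(fderiv ℝ e y).det| = c * (σ y * (grad u y ⬝ᵥ grad u y)) := by
  have hg := contDiff_grad hu
  have hgi (i : Fin 2) : ContDiff ℝ 1 fun z => σ z * grad u z i := hσ.mul (contDiff_pi.1 hg i)
  obtain ⟨v, hv, hvg⟩ := exists_contDiff_grad_eq (p := fun z => -(σ z * grad u z 1))
    (q := fun z => σ z * grad u z 0) (hgi 1).neg (hgi 0) (fun y => by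
      have := hdiv y
      rw [Fin.sum_univ_two] at this
      rw [fderiv_fun_neg, _root_.neg_apply]
      linarith)
  have hvper : ZdPeriodic fun y => grad v y := fun κ y => by
    have h1 := hσper κ y
    have h2 := huper κ y
    simp only at h2
    simp only [hvg, h1, h2]
  have hu1 : ContDiff ℝ 1 u := hu.of_le (by norm_num)
  have hud := hu1.differentiable one_ne_zero
  have hvd := hv.differentiable one_ne_zero
  obtain ⟨ξ, hξ⟩ := exists_forall_add_eq_of_periodic_fderiv hud huper.fderiv_of_grad
  obtain ⟨η, hη⟩ := exists_forall_add_eq_of_periodic_fderiv hvd hvper.fderiv_of_grad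
  have hint : IntegrableOn (fun y => σ y • grad u y) (unitCube 2) :=
    (hσ.continuous.smul hg.continuous).integrableOn_unitCube
  have hζi (i : Fin 2) : ζ i = ∫ y in unitCube 2, σ y * grad u y i := by
    rw [hζ, eval_integral fun j => hint.eval j]
    rfl
  have hη0 : η 0 = -ζ 1 := by
    rw [← setIntegral_fderiv_unitCube hv hη, hζi, ← integral_neg]
    refine integral_congr_ae (Eventually.of_forall fun y => ?_)
    exact congrFun (hvg y) 0
  have hη1 : η 1 = ζ 0 := by
    rw [← setIntegral_fderiv_unitCube hv hη, hζi]
    refine integral_congr_ae (Eventually.of_forall fun y => ?_)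
    exact congrFun (hvg y) 1
  have hζ0 : ζ 0 ≠ 0 := by
    have := herg (Pi.single 0 1) (by simp)
    simpa [dotProduct] using this
  have hfu (y w) : fderiv ℝ u y w = w ⬝ᵥ grad u y := (fderiv ℝ u y).apply_eq_dotProduct w
  have hfv (y w) : fderiv ℝ v y w = w ⬝ᵥ grad v y := (fderiv ℝ v y).apply_eq_dotProduct w
  set D : ℝ := ξ 0 * η 1 - ξ 1 * η 0 with hD
  have hD0 : D ≠ 0 := by
    intro h0
    have hper : ZdPeriodic fun y => η 1 * u y - ξ 1 * v y := fun κ y => by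
      simp only [hξ, hη, dotProduct, Fin.sum_univ_two]
      linear_combination (κ 0 : ℝ) * (h0 - hD)
    obtain ⟨y₀, hy₀⟩ := hper.exists_isMaxOn
      ((continuous_const.mul hu1.continuous).sub (continuous_const.mul hv.continuous))
    have hz := grad_eq_zero_of_forall_le hy₀
    have hi (i : Fin 2) : η 1 * grad u y₀ i - ξ 1 * grad v y₀ i = 0 := by
      have := congrFun hz i
      rw [grad, fderiv_fun_sub ((hud y₀).const_mul _) ((hvd y₀).const_mul _),
        fderiv_const_mul (hud y₀), fderiv_const_mul (hvd y₀)] at this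
      exact this
    have h1 := hi 0
    have h2 := hi 1
    rw [hvg] at h1 h2
    have hpos := dotProduct_self_pos_of_ne_zero (hune y₀)
    simp only [dotProduct, Fin.sum_univ_two] at hpos
    simp only [Matrix.cons_val_zero, Matrix.cons_val_one] at h1 h2
    have : η 1 * (grad u y₀ 0 * grad u y₀ 0 + grad u y₀ 1 * grad u y₀ 1) = 0 := by
      linear_combination grad u y₀ 0 * h1 + grad u y₀ 1 * h2
    rcases mul_eq_zero.1 this with h | h
    · exact hζ0 (hη1 ▸ h)
    · exact hpos.ne' h
  let G : (Fin 2 → ℝ) → (Fin 2 → ℝ) := fun y i =>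
    ![D⁻¹ * (η 1 * u y - ξ 1 * v y), D⁻¹ * (ξ 0 * v y - η 0 * u y)] i
  let G' : (Fin 2 → ℝ) → Fin 2 → ((Fin 2 → ℝ) →L[ℝ] ℝ) := fun y =>
    ![D⁻¹ • (η 1 • fderiv ℝ u y - ξ 1 • fderiv ℝ v y),
      D⁻¹ • (ξ 0 • fderiv ℝ v y - η 0 • fderiv ℝ u y)]
  have hGd (y) : HasFDerivAt G (ContinuousLinearMap.pi (G' y)) y := by
    have hu' := (hud y).hasFDerivAt
    have hv' := (hvd y).hasFDerivAt
    rw [hasFDerivAt_pi]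
    intro i
    fin_cases i
    · exact ((hu'.const_mul (η 1)).sub (hv'.const_mul (ξ 1))).const_mul D⁻¹
    · exact ((hv'.const_mul (ξ 0)).sub (hu'.const_mul (η 0))).const_mul D⁻¹
  have hGC : ContDiff ℝ 1 G := by
    rw [contDiff_pi]
    intro i
    fin_cases i
    · exact contDiff_const.mul ((contDiff_const.mul hu1).sub (contDiff_const.mul hv))
    · exact contDiff_const.mul ((contDiff_const.mul hv).sub (contDiff_const.mul hu1))
  have hdet (y) : (fderiv ℝ G y).det = D⁻¹ * (σ y * (grad u y ⬝ᵥ grad u y)) := by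
    rw [(hGd y).fderiv, ContinuousLinearMap.det, ← LinearMap.det_toMatrix', Matrix.det_fin_two]
    simp only [LinearMap.toMatrix'_apply, G', ContinuousLinearMap.coe_coe,
      ContinuousLinearMap.coe_pi', Matrix.cons_val_zero, Matrix.cons_val_one,
      _root_.smul_apply, _root_.sub_apply, smul_eq_mul, hfu, hfv,
      hvg, dotProduct, Fin.sum_univ_two]
    simp
    field_simp
    rw [hD]
    ring
  have hdot (y) : 0 < grad u y ⬝ᵥ grad u y := dotProduct_self_pos_of_ne_zero (hune y)
  have heq (κ : Fin 2 → ℤ) (y : Fin 2 → ℝ) :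
      G (y + fun i => (κ i : ℝ)) = G y + fun i => (κ i : ℝ) := by
    funext i
    fin_cases i
    · simp only [G, hξ, hη, dotProduct, Fin.sum_univ_two, Pi.add_apply]
      simp
      field_simp
      rw [hD]
      ring
    · simp only [G, hξ, hη, dotProduct, Fin.sum_univ_two, Pi.add_apply]
      simp
      field_simp
      rw [hD]
      ring
  obtain ⟨e, he⟩ := exists_homeomorph_of_equivariant hGC (fun y => by
    rw [hdet]
    exact mul_ne_zero (inv_ne_zero hD0) (mul_pos (hσpos y) (hdot y)).ne') heq
  refine ⟨e, D⁻¹ • ζ, |D⁻¹|, abs_pos.2 (inv_ne_zero hD0), fun κ hκ => ?_, ?_, ?_, fun y => ?_,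
    fun y => ?_⟩
  · rw [smul_dotProduct]
    exact mul_ne_zero (inv_ne_zero hD0) (herg κ hκ)
  · rw [he]
    exact hGC.differentiable one_ne_zero
  · rwa [he]
  · rw [he, (hGd y).fderiv]
    funext i
    fin_cases i
    · simp [G', hfu, hfv, hvg, dotProduct, Fin.sum_univ_two, hη1]
      ring
    · simp [G', hfu, hfv, hvg, dotProduct, Fin.sum_univ_two, hη0]
      ring
  · rw [he, hdet, abs_mul, abs_of_pos (mul_pos (hσpos y) (hdot y))]

theorem ZdPeriodic.setIntegral_comp_symm_of_equivariant {d : ℕ}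
    {e : (Fin d → ℝ) ≃ₜ (Fin d → ℝ)} (hed : Differentiable ℝ e)
    (heq : ∀ (κ : Fin d → ℤ) (y : Fin d → ℝ),
      e (y + fun i => (κ i : ℝ)) = e y + fun i => (κ i : ℝ))
    {φ : (Fin d → ℝ) → ℝ} (hφ : ZdPeriodic φ) :
    ZdPeriodic (fun z => φ (e.symm z)) ∧
      ∫ z in unitCube d, φ (e.symm z) = ∫ y in unitCube d, |(fderiv ℝ e y).det| * φ y := by
  have hsymm (κ : Fin d → ℤ) (z : Fin d → ℝ) :
      e.symm (z + fun i => (κ i : ℝ)) = e.symm z + fun i => (κ i : ℝ) := by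
    rw [e.symm_apply_eq, heq, e.apply_symm_apply]
  have hper : ZdPeriodic (fun z => φ (e.symm z)) := fun κ z => by
    simp only [hsymm]
    exact hφ κ _
  refine ⟨hper, ?_⟩
  have hmem (z : Fin d → ℝ) : z ∈ e '' unitCube d ↔ e.symm z ∈ unitCube d := by
    rw [e.image_eq_preimage_symm]
    rfl
  rw [← hper.setIntegral_eq (D := e '' unitCube d)
    (e.measurableEmbedding.measurableSet_image' (measurableSet_unitCube d)) fun z => by
      simp only [hmem, hsymm]
      exact existsUnique_add_mem_unitCube _,
    integral_image_eq_integral_abs_det_fderiv_smul volume (measurableSet_unitCube d)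
      (fun y _ => (hed y).hasFDerivAt.hasFDerivWithinAt) e.injective.injOn]
  simp

theorem tendsto_average_of_straightening {d : ℕ} {b : (Fin d → ℝ) → (Fin d → ℝ)}
    {σ ρ : (Fin d → ℝ) → ℝ} (hσ1 : ∫ y in unitCube d, σ y = 1)
    (hρ : Continuous ρ) (hρper : ZdPeriodic ρ) (hρpos : ∀ y, 0 < ρ y)
    {e : (Fin d → ℝ) ≃ₜ (Fin d → ℝ)} {ω : Fin d → ℝ} {c : ℝ} (hc : 0 < c)
    (hω : ∀ κ : Fin d → ℤ, κ ≠ 0 → ω ⬝ᵥ (fun i => (κ i : ℝ)) ≠ 0)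
    (hed : Differentiable ℝ e)
    (heq : ∀ (κ : Fin d → ℤ) (y : Fin d → ℝ),
      e (y + fun i => (κ i : ℝ)) = e y + fun i => (κ i : ℝ))
    (heb : ∀ y, fderiv ℝ e y (b y) = ρ y • ω)
    (hdet : ∀ y, |(fderiv ℝ e y).det| = c * (σ y * ρ y))
    {γ : ℝ → Fin d → ℝ} (hγ : ∀ t, HasDerivAt γ (b (γ t)) t)
    {ψ : (Fin d → ℝ) → ℝ} (hψ : Continuous ψ) (hψper : ZdPeriodic ψ) :
    Tendsto (fun T : ℝ => T⁻¹ * ∫ t in 0..T, ψ (γ t)) atTop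
      (nhds (∫ y in unitCube d, σ y * ψ y)) := by
  have hγc : Continuous γ := continuous_iff_continuousAt.2 fun t => (hγ t).continuousAt
  set τ : ℝ → ℝ := fun T => ∫ t in 0..T, ρ (γ t) with hτdef
  have hτ (T : ℝ) : HasDerivAt τ (ρ (γ T)) T :=
    ((hρ.comp hγc).integral_hasStrictDerivAt 0 T).hasDerivAt
  have hline (T : ℝ) : e (γ T) = e (γ 0) + τ T • ω := by
    have hd (t : ℝ) : HasDerivAt (fun t => e (γ t) - τ t • ω) 0 t := by
      have := ((hed (γ t)).hasFDerivAt.comp_hasDerivAt t (hγ t)).sub ((hτ t).smul_const ω)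
      rwa [heb, sub_self] at this
    have := is_const_of_deriv_eq_zero (fun t => (hd t).differentiableAt)
      (fun t => (hd t).deriv) T 0
    simp only [hτdef, intervalIntegral.integral_same, zero_smul, sub_zero] at this
    rw [← this, sub_add_cancel]
  obtain ⟨m, hm, hmρ⟩ := hρper.exists_pos_le hρ hρpos
  have hτtop : Tendsto τ atTop atTop := by
    refine tendsto_atTop_mono' _ ?_ (tendsto_id.const_mul_atTop hm)
    filter_upwards [eventually_ge_atTop 0] with T hT
    have := intervalIntegral.integral_mono_on (μ := volume) (f := fun _ => m) hT
      intervalIntegrable_const ((hρ.comp hγc).intervalIntegrable 0 T) fun t _ => hmρ (γ t)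
    simpa [mul_comm] using this
  have key {φ : (Fin d → ℝ) → ℝ} (hφ : Continuous φ) (hφper : ZdPeriodic φ) :
      Tendsto (fun T => (τ T)⁻¹ * ∫ t in 0..T, φ (γ t)) atTop
        (nhds (c * ∫ y in unitCube d, σ y * φ y)) := by
    have hqc : Continuous fun y => φ y / ρ y := hφ.div hρ fun y => (hρpos y).ne'
    have hqper : ZdPeriodic fun y => φ y / ρ y := fun κ y => by
      simp only [hφper κ y, hρper κ y]
    obtain ⟨hper, hint⟩ := hqper.setIntegral_comp_symm_of_equivariant hed heq
    have hmean : ∫ z in unitCube d, φ (e.symm z) / ρ (e.symm z)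
        = c * ∫ y in unitCube d, σ y * φ y := by
      rw [hint, ← integral_const_mul]
      congr 1 with y
      rw [hdet]
      field_simp [(hρpos y).ne']
    have hlim := hper.tendsto_average_line hω (hqc.comp e.symm.continuous) (e (γ 0))
    rw [hmean] at hlim
    refine (hlim.comp hτtop).congr fun T => ?_
    have hsub := intervalIntegral.integral_comp_mul_deriv (a := 0) (b := T)
      (g := fun s => φ (e.symm (e (γ 0) + s • ω)) / ρ (e.symm (e (γ 0) + s • ω)))
      (fun t _ => hτ t) (hρ.comp hγc).continuousOn
      ((hqc.comp e.symm.continuous).comp (by fun_prop))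
    have hτ0 : τ 0 = 0 := intervalIntegral.integral_same
    rw [hτ0] at hsub
    simp only [Function.comp_apply]
    rw [← hsub]
    congr 2 with t
    simp only [Function.comp_apply, ← hline, e.symm_apply_apply]
    field_simp [(hρpos (γ t)).ne']
  have h1 := key (φ := fun _ => 1) continuous_const fun _ _ => rfl
  simp only [mul_one, hσ1, intervalIntegral.integral_const, sub_zero, smul_eq_mul] at h1
  have hq := (key hψ hψper).div h1 hc.ne'
  rw [mul_div_cancel_left₀ _ hc.ne'] at hq
  refine hq.congr' ?_
  filter_upwards [hτtop.eventually_gt_atTop 0] with T hT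
  rw [Pi.div_apply, mul_div_mul_left _ _ (inv_pos.2 hT).ne', div_eq_inv_mul]

theorem ZdPeriodic.exists_lipschitzWith {d : ℕ} {b : (Fin d → ℝ) → (Fin d → ℝ)}
    (hp : ZdPeriodic b) (hb : ContDiff ℝ 1 b) : ∃ K, LipschitzWith K b := by
  have hp' : ZdPeriodic (fderiv ℝ b) := fun κ y => by
    rw [← fderiv_comp_add_right]
    congr 1
    exact funext (hp κ)
  obtain ⟨C, hC⟩ := hp'.exists_norm_le (hb.continuous_fderiv one_ne_zero)
  refine ⟨C.toNNReal, lipschitzWith_of_nnnorm_fderiv_le (hb.differentiable one_ne_zero)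
    fun y => ?_⟩
  exact NNReal.le_toNNReal_of_coe_le (hC y)

namespace IsFlowOf

variable {d : ℕ} {b : (Fin d → ℝ) → (Fin d → ℝ)} {X : ℝ → (Fin d → ℝ) → (Fin d → ℝ)}
  {K : NNReal}

theorem continuous_time (hX : IsFlowOf b X) (x : Fin d → ℝ) : Continuous fun t => X t x :=
  continuous_iff_continuousAt.2 fun t => ((hX x).2 t).continuousAt

theorem eq_of_hasDerivAt (hX : IsFlowOf b X) (hb : LipschitzWith K b) {γ : ℝ → Fin d → ℝ}
    (hγ : ∀ t, HasDerivAt γ (b (γ t)) t) (t : ℝ) : γ t = X t (γ 0) := by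
  refine congrFun (ODE_solution_unique_univ (v := fun _ => b) (s := fun _ => Set.univ) (t₀ := 0)
    (fun _ => hb.lipschitzOnWith) (fun t => ⟨hγ t, trivial⟩)
    (fun t => ⟨(hX (γ 0)).2 t, trivial⟩) (hX (γ 0)).1.symm) t

theorem comp_eq (hX : IsFlowOf b X) (hb : LipschitzWith K b) (s t : ℝ) (x : Fin d → ℝ) :
    X t (X s x) = X (t + s) x := by
  have := hX.eq_of_hasDerivAt hb (γ := fun t => X (t + s) x)
    (fun t => ((hX x).2 (t + s)).comp_add_const t s) t
  simpa using this.symm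

theorem map_add_int (hX : IsFlowOf b X) (hb : LipschitzWith K b) (hp : ZdPeriodic b) (t : ℝ)
    (κ : Fin d → ℤ) (x : Fin d → ℝ) :
    X t (x + fun i => (κ i : ℝ)) = X t x + fun i => (κ i : ℝ) := by
  have := hX.eq_of_hasDerivAt hb (γ := fun t => X t x + fun i => (κ i : ℝ))
    (fun t => by simpa only [hp κ] using ((hX x).2 t).add_const _) t
  simpa [(hX x).1] using this.symm

theorem dist_le (hX : IsFlowOf b X) (hb : LipschitzWith K b) {t : ℝ} (ht : 0 ≤ t)
    (x y : Fin d → ℝ) : dist (X t x) (X t y) ≤ dist x y * Real.exp (K * t) := by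
  have := dist_le_of_trajectories_ODE (v := fun _ => b) (a := 0) (b := t) (δ := dist x y)
    (fun _ => hb) (hX.continuous_time x).continuousOn
    (fun s _ => ((hX x).2 s).hasDerivWithinAt) (hX.continuous_time y).continuousOn
    (fun s _ => ((hX y).2 s).hasDerivWithinAt) (by rw [(hX x).1, (hX y).1]) t ⟨ht, le_rfl⟩
  simpa using this

theorem reverse (hX : IsFlowOf b X) : IsFlowOf (fun y => -b y) fun t => X (-t) := by
  refine fun x => ⟨by simp [(hX x).1], fun t => ?_⟩
  have := ((hX x).2 (-t)).scomp t (hasDerivAt_neg t)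
  rwa [neg_one_smul] at this

theorem continuous_space (hX : IsFlowOf b X) (hb : LipschitzWith K b) (t : ℝ) :
    Continuous (X t) := by
  wlog ht : 0 ≤ t generalizing b X t
  · simpa using this hX.reverse (LipschitzWith.of_dist_le_mul fun x y => by
      simpa using hb.dist_le_mul x y) (-t) (by linarith)
  · refine (LipschitzWith.of_dist_le_mul (K := ⟨Real.exp (K * t), (Real.exp_pos _).le⟩)
      fun x y => ?_).continuous
    exact (hX.dist_le hb ht x y).trans_eq (mul_comm _ _)

variable {σ : (Fin d → ℝ) → ℝ}

/-- If the time averages along the flow converge, every invariant probability measure is given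
by the limit. -/
theorem integral_eq_of_tendsto_average (hX : IsFlowOf b X) (hb : LipschitzWith K b)
    {μ : Measure (Fin d → ℝ)} [IsProbabilityMeasure μ] (hμ : FlowInvariant X μ)
    {ψ : (Fin d → ℝ) → ℝ} (hψ : Continuous ψ) (hψper : ZdPeriodic ψ) {l : ℝ}
    (hlim : ∀ x, Tendsto (fun T : ℝ => T⁻¹ * ∫ t in 0..T, ψ (X t x)) atTop (nhds l)) :
    ∫ y, ψ y ∂μ = l := by
  obtain ⟨C, hC⟩ := hψper.exists_norm_le hψ
  have hmeas : Measurable (Function.uncurry fun t x => ψ (X t x)) :=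
    measurable_uncurry_of_continuous_of_measurable
      (fun x => hψ.comp (hX.continuous_time x))
      fun t => (hψ.comp (hX.continuous_space hb t)).measurable
  have hint (T : ℝ) : Integrable (Function.uncurry fun t x => ψ (X t x))
      ((volume.restrict (Set.uIoc 0 T)).prod μ) := by
    have : IsFiniteMeasure (volume.restrict (Set.uIoc 0 T)) := ⟨by simp [Set.uIoc]⟩
    exact Integrable.of_bound hmeas.aestronglyMeasurable C (Eventually.of_forall fun p => hC _)
  have hsm (T : ℝ) : AEStronglyMeasurable (fun x => T⁻¹ * ∫ t in 0..T, ψ (X t x)) μ := by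
    have hi := (hint T).integral_prod_right.aestronglyMeasurable
    simp only [intervalIntegral.intervalIntegral_eq_integral_uIoc]
    exact (hi.const_smul (if 0 ≤ T then (1 : ℝ) else -1)).const_mul _
  have hswap (T : ℝ) (hT : 0 < T) :
      ∫ x, (T⁻¹ * ∫ t in 0..T, ψ (X t x)) ∂μ = ∫ y, ψ y ∂μ := by
    rw [integral_const_mul, ← intervalIntegral_integral_swap (hint T)]
    simp only [hμ _ ψ hψ hψper, intervalIntegral.integral_const, sub_zero, smul_eq_mul]
    field_simp
  have hdom : Tendsto (fun T : ℝ => ∫ x, (T⁻¹ * ∫ t in 0..T, ψ (X t x)) ∂μ) atTop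
      (nhds (∫ _, l ∂μ)) := by
    refine tendsto_integral_filter_of_dominated_convergence (fun _ => C)
      (Eventually.of_forall hsm) ?_ (integrable_const C) (Eventually.of_forall hlim)
    filter_upwards [eventually_gt_atTop 0] with T hT
    refine Eventually.of_forall fun x => ?_
    have := intervalIntegral.norm_integral_le_of_norm_le_const (a := 0) (b := T)
      fun t _ => hC (X t x)
    rw [norm_mul, norm_inv, Real.norm_of_nonneg hT.le, inv_mul_le_iff₀ hT, mul_comm]
    rwa [sub_zero, abs_of_pos hT] at this
  simp only [integral_const, probReal_univ, one_smul] at hdom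
  refine tendsto_nhds_unique (tendsto_const_nhds.congr' ?_) hdom
  filter_upwards [eventually_gt_atTop 0] with T hT using (hswap T hT).symm

/-- If the time averages along the flow converge to averages with density `σ`, these are invariant
under the flow. -/
theorem integral_comp_eq_of_tendsto_average (hX : IsFlowOf b X) (hb : LipschitzWith K b)
    (hp : ZdPeriodic b)
    (hlim : ∀ ψ : (Fin d → ℝ) → ℝ, Continuous ψ → ZdPeriodic ψ → ∀ x,
      Tendsto (fun T : ℝ => T⁻¹ * ∫ t in 0..T, ψ (X t x)) atTop
        (nhds (∫ y in unitCube d, σ y * ψ y)))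
    {ψ : (Fin d → ℝ) → ℝ} (hψ : Continuous ψ) (hψper : ZdPeriodic ψ) (s : ℝ) :
    ∫ y in unitCube d, σ y * ψ (X s y) = ∫ y in unitCube d, σ y * ψ y := by
  obtain ⟨C, hC⟩ := hψper.exists_norm_le hψ
  have h1 := hlim (fun y => ψ (X s y)) (hψ.comp (hX.continuous_space hb s)) (fun κ y => by
    simp only [hX.map_add_int hb hp]
    exact hψper κ _) 0
  have h2 := hlim ψ hψ hψper 0
  have hc : Continuous fun t => ψ (X t 0) := hψ.comp (hX.continuous_time 0)
  have hI (p q : ℝ) : IntervalIntegrable (fun t => ψ (X t 0)) volume p q :=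
    hc.intervalIntegrable p q
  refine eq_of_sub_eq_zero (tendsto_nhds_unique (h1.sub h2) ?_)
  have hz : Tendsto (fun T : ℝ => T⁻¹ * (2 * (C * |s|))) atTop (nhds 0) := by
    simpa using tendsto_inv_atTop_zero.mul_const (2 * (C * |s|))
  refine squeeze_zero_norm' ?_ hz
  filter_upwards [eventually_gt_atTop 0] with T hT
  simp only [hX.comp_eq hb]
  have hshift : ∫ t in 0..T, ψ (X (s + t) 0) = ∫ t in s..s + T, ψ (X t 0) := by
    rw [intervalIntegral.integral_comp_add_left (fun t => ψ (X t 0)) s, add_zero]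
  rw [hshift, ← mul_sub, norm_mul, norm_inv, Real.norm_of_nonneg hT.le]
  refine mul_le_mul_of_nonneg_left ?_ (inv_nonneg.2 hT.le)
  rw [intervalIntegral.integral_interval_sub_interval_comm (hI _ _) (hI _ _) (hI _ _), two_mul]
  have hb1 := intervalIntegral.norm_integral_le_of_norm_le_const (a := s) (b := 0)
    fun t _ => hC (X t 0)
  have hb2 := intervalIntegral.norm_integral_le_of_norm_le_const (a := s + T) (b := T)
    fun t _ => hC (X t 0)
  refine (norm_sub_le _ _).trans (add_le_add (hb1.trans_eq ?_) (hb2.trans_eq ?_))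
  · simp
  · simp

/-- If the time averages along the flow converge to averages with density `σ`, the flow has the
single rotation vector `∫ σ • b`. -/
theorem tendsto_and_rotationSet_eq_of_tendsto_average (hX : IsFlowOf b X) (hb : ContDiff ℝ 1 b)
    (hp : ZdPeriodic b) (hσ : Continuous σ) (hσpos : ∀ y, 0 < σ y)
    (hσ1 : ∫ y in unitCube d, σ y = 1)
    (hlim : ∀ ψ : (Fin d → ℝ) → ℝ, Continuous ψ → ZdPeriodic ψ → ∀ x,
      Tendsto (fun T : ℝ => T⁻¹ * ∫ t in 0..T, ψ (X t x)) atTop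
        (nhds (∫ y in unitCube d, σ y * ψ y))) :
    (∀ x, Tendsto (fun t : ℝ => t⁻¹ • X t x) atTop
      (nhds (∫ y in unitCube d, σ y • b y))) ∧
    rotationSet b X = {∫ y in unitCube d, σ y • b y} := by
  obtain ⟨K, hK⟩ := hp.exists_lipschitzWith hb
  have hbi (i : Fin d) : Continuous fun y => b y i := (continuous_apply i).comp hb.continuous
  have hpi (i : Fin d) : ZdPeriodic fun y => b y i := fun κ y => congrFun (hp κ y) i
  have hint : IntegrableOn (fun y => σ y • b y) (unitCube d) :=
    (hσ.smul hb.continuous).integrableOn_unitCube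
  have hζi (i : Fin d) :
      (∫ y in unitCube d, σ y • b y) i = ∫ y in unitCube d, σ y * b y i := by
    rw [eval_integral fun j => hint.eval j]
    rfl
  refine ⟨fun x => tendsto_pi_nhds.2 fun i => ?_, Set.Subset.antisymm ?_ ?_⟩
  · have hXi (T : ℝ) : X T x i = x i + ∫ t in 0..T, b (X t x) i := by
      rw [intervalIntegral.integral_eq_sub_of_hasDerivAt
        (fun t _ => hasDerivAt_pi.1 ((hX x).2 t) i)
        (((hbi i).comp (hX.continuous_time x)).intervalIntegrable 0 T), (hX x).1]
      ring
    have h := (tendsto_inv_atTop_zero.mul_const (x i)).add (hlim _ (hbi i) (hpi i) x)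
    rw [zero_mul, zero_add, ← hζi] at h
    refine h.congr fun T => ?_
    rw [Pi.smul_apply, hXi, smul_eq_mul, mul_add]
  · rintro _ ⟨μ, hμ, -, hinv, rfl⟩
    obtain ⟨C, hC⟩ := hp.exists_norm_le hb.continuous
    have hbμ : Integrable b μ := Integrable.of_bound hb.continuous.aestronglyMeasurable C
      (Eventually.of_forall hC)
    rw [Set.mem_singleton_iff]
    funext i
    rw [hζi, eval_integral fun j => hbμ.eval j]
    exact hX.integral_eq_of_tendsto_average hK hinv (hbi i) (hpi i) (hlim _ (hbi i) (hpi i))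
  · rintro _ rfl
    have hd (E : Type) [NormedAddCommGroup E] [NormedSpace ℝ E] (f : (Fin d → ℝ) → E) :
        ∫ y, f y ∂((volume.restrict (unitCube d)).withDensity fun y => ENNReal.ofReal (σ y))
          = ∫ y in unitCube d, σ y • f y := by
      rw [integral_withDensity_eq_integral_toReal_smul₀ (by fun_prop) (by simp)]
      simp only [ENNReal.toReal_ofReal (hσpos _).le]
    refine ⟨(volume.restrict (unitCube d)).withDensity fun y => ENNReal.ofReal (σ y),
      ⟨?_⟩, ?_, fun t ψ hψ hψper => ?_, (hd _ b).symm⟩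
    · rw [withDensity_apply _ MeasurableSet.univ, Measure.restrict_univ,
        ← ofReal_integral_eq_lintegral_ofReal hσ.integrableOn_unitCube
          (Eventually.of_forall fun y => (hσpos y).le), hσ1, ENNReal.ofReal_one]
    · refine withDensity_absolutelyContinuous _ _ ?_
      rw [Measure.restrict_apply (measurableSet_unitCube d).compl, Set.compl_inter_self,
        measure_empty]
    · rw [hd, hd]
      exact hX.integral_comp_eq_of_tendsto_average hK hp hlim hψ hψper t

end IsFlowOf

/-- Let `σ ∈ C¹_♯(Y₂)` be positive with `∫_{Y₂} σ = 1`, let `u` be `C²` with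
`∇u ∈ C¹_♯(Y₂)²` nowhere vanishing and `σ∇u` divergence free in `ℝ²`, and let
`ζ := ∫_{Y₂} σ∇u dy` satisfy the ergodicity condition `ζ·κ ≠ 0` for all `κ ∈ ℤ²∖{0}`.
Then the flow `X` of the electric field `b := ∇u` satisfies `X(t,x)/t → ζ` for every `x`
(equivalently, `C_b = {ζ}`). -/
theorem flow_asymptotics_electric_field_dimension_two
    (σ : (Fin 2 → ℝ) → ℝ) (hσ : ContDiff ℝ 1 σ) (hσper : ZdPeriodic σ) (hσpos : ∀ y, 0 < σ y)
    (hσ1 : ∫ y in unitCube 2, σ y = 1)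
    (u : (Fin 2 → ℝ) → ℝ) (hu : ContDiff ℝ 2 u)
    (huper : ZdPeriodic fun y => grad u y) (hune : ∀ y, grad u y ≠ 0)
    (hdiv : ∀ y : Fin 2 → ℝ,
      ∑ i : Fin 2, fderiv ℝ (fun z => σ z * grad u z i) y (Pi.single i 1) = 0)
    (ζ : Fin 2 → ℝ) (hζ : ζ = ∫ y in unitCube 2, σ y • grad u y)
    (herg : ∀ κ : Fin 2 → ℤ, κ ≠ 0 → ζ ⬝ᵥ (fun i => (κ i : ℝ)) ≠ 0)
    (X : ℝ → (Fin 2 → ℝ) → (Fin 2 → ℝ)) (hX : IsFlowOf (fun y => grad u y) X) :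
    (∀ x, Tendsto (fun t : ℝ => t⁻¹ • X t x) atTop (nhds ζ)) ∧
    rotationSet (fun y => grad u y) X = {ζ} := by

  obtain ⟨e, ω, c, hc, hω, hed, heq, heb, hdet⟩ :=
    exists_straightening hσ hσper hσpos hu huper hune hdiv hζ herg
  have hg := (contDiff_grad hu).continuous
  subst hζ
  refine hX.tendsto_and_rotationSet_eq_of_tendsto_average (contDiff_grad hu) huper hσ.continuous
    hσpos hσ1 fun ψ hψ hψper x => ?_
  exact tendsto_average_of_straightening hσ1 (hg.dotProduct hg)
    (fun κ y => congrArg (fun w => w ⬝ᵥ w) (huper κ y))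
    (fun y => dotProduct_self_pos_of_ne_zero (hune y)) hc hω hed heq heb hdet (hX x).2 hψ hψper
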